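/- arXiv:1302.0812 — 3 statements merged into one kernel-verified Lean document; each statement's English description precedes it below -/
import Mathlib

section
/- Let k ≥ 0 be an integer, and let H and J be cographs, each of height k+1, such that H is anticonnected and J is connected. Then there exists an integer P > 0 such that every {H,J}-free graph admits a (c(H) ∪ ac(J), P)-partition. -/
/-- A graph `G` contains a graph `H` if some induced subgraph of `G` is isomorphic to `H`. -/
def Contains {α β : Type} (G : SimpleGraph α) (H : SimpleGraph β) : Prop :=
  ∃ s : Set α, Nonempty ((G.induce s) ≃g H)

/-- `G` is `H`-free if `G` does not contain `H`. -/
def Free {α β : Type} (G : SimpleGraph α) (H : SimpleGraph β) : Prop := ¬ Contains G H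

/-- `CographHeight G k` says that `G` is a cograph of height exactly `k`:
a one-vertex graph has height `0`; if `G` is not connected its height is one more than
the maximum height of its components; if `G` is not anticonnected its height is one more
than the maximum height of its anticomponents. -/
inductive CographHeight : ∀ {V : Type}, SimpleGraph V → ℕ → Prop
  | single {V : Type} (G : SimpleGraph V) (v : V) (hv : ∀ w, w = v) : CographHeight G 0
  | union {V : Type} (G : SimpleGraph V) (k : ℕ) (h : ¬ G.Connected)
      (ht : G.ConnectedComponent → ℕ)
      (hc : ∀ c : G.ConnectedComponent, CographHeight (G.induce c.supp) (ht c))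
      (hle : ∀ c, ht c ≤ k) (hmax : ∃ c, ht c = k) :
      CographHeight G (k + 1)
  | join {V : Type} (G : SimpleGraph V) (k : ℕ) (h : ¬ Gᶜ.Connected)
      (ht : Gᶜ.ConnectedComponent → ℕ)
      (hc : ∀ c : Gᶜ.ConnectedComponent, CographHeight (G.induce c.supp) (ht c))
      (hle : ∀ c, ht c ≤ k) (hmax : ∃ c, ht c = k) :
      CographHeight G (k + 1)


/-- The vertex type `γ` can be partitioned into `P` subsets each of which is a singleton
or satisfies the predicate `Ok`. -/
def HasPartition {γ : Type} (P : ℕ) (Ok : Set γ → Prop) : Prop :=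
  ∃ X : Fin P → Set γ, (⋃ i, X i) = Set.univ ∧
    (Pairwise fun i j => Disjoint (X i) (X j)) ∧
    ∀ i, (∃ v, X i = {v}) ∨ Ok (X i)

/-- `A` can be coloured with `n` colours in such a way that every colour class is good. -/
def Coverable {γ : Type} (Good : Set γ → Prop) (n : ℕ) (A : Set γ) : Prop :=
  ∃ f : γ → ℕ, (∀ x ∈ A, f x < n) ∧ ∀ i, Good {x ∈ A | f x = i}

/-- The subgraph of `H` induced on `s` embeds as an induced subgraph into `G`, inside `A`. -/
def EmbedsIn {α γ : Type} (H : SimpleGraph α) (G : SimpleGraph γ) (s : Set α) (A : Set γ) :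
    Prop :=
  ∃ f : s → γ, (∀ x, f x ∈ A) ∧ Function.Injective f ∧
    ∀ x y, G.Adj (f x) (f y) ↔ H.Adj x y

namespace Coverable

variable {γ : Type} {Good : Set γ → Prop} {m n : ℕ} {A B : Set γ}

theorem mono (hG : Antitone Good) (hmn : m ≤ n) (hAB : A ⊆ B) (h : Coverable Good m B) :
    Coverable Good n A := by
  obtain ⟨f, hf, hgood⟩ := h
  exact ⟨f, fun x hx => (hf x (hAB hx)).trans_le hmn,
    fun i => hG (Set.inter_subset_inter_left _ hAB) (hgood i)⟩

theorem of_good (hG : Antitone Good) (hA : Good A) : Coverable Good 1 A :=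
  ⟨fun _ => 0, fun _ _ => Nat.one_pos, fun _ => hG (Set.sep_subset _ _) hA⟩

theorem union (hG : Antitone Good) (hA : Coverable Good m A) (hB : Coverable Good n B) :
    Coverable Good (m + n) (A ∪ B) := by
  classical
  obtain ⟨f, hf, hfg⟩ := hA
  obtain ⟨g, hg, hgg⟩ := hB
  refine ⟨fun x => if x ∈ A then f x else m + g x, ?_, fun i => ?_⟩
  · intro x hx
    by_cases hxA : x ∈ A
    · have := hf x hxA
      simp only [hxA, if_true]
      omega
    · have := hg x (hx.resolve_left hxA)
      simp only [hxA, if_false]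
      omega
  · by_cases hi : i < m
    · refine hG ?_ (hfg i)
      rintro x ⟨hx, hxi⟩
      by_cases hxA : x ∈ A
      · exact ⟨hxA, by simpa [hxA] using hxi⟩
      · simp only [hxA, if_false] at hxi
        omega
    · refine hG ?_ (hgg (i - m))
      rintro x ⟨hx, hxi⟩
      by_cases hxA : x ∈ A
      · have := hf x hxA
        simp only [hxA, if_true] at hxi
        omega
      · simp only [hxA, if_false] at hxi
        exact ⟨hx.resolve_left hxA, by omega⟩

theorem biUnion {ι : Type} (hG : Antitone Good) (hsub : ∀ X : Set γ, X.Subsingleton → Good X)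
    (s : Finset ι) (C : ι → Set γ) (h : ∀ i ∈ s, Coverable Good n (C i)) :
    Coverable Good (s.card * n) (⋃ i ∈ s, C i) := by
  classical
  induction s using Finset.induction_on with
  | empty => exact ⟨fun _ => 0, by simp, fun i => hsub _ (by simp)⟩
  | insert a s ha ih =>
    rw [Finset.set_biUnion_insert]
    refine ((h a (by simp)).union hG (ih fun i hi => h i (by simp [hi]))).mono hG ?_ subset_rfl
    rw [Finset.card_insert_of_notMem ha]
    exact le_of_eq (by ring)

end Coverable

section Unavoidable

variable {γ : Type} {Good : Set γ → Prop} {p c : ℕ} {U : Set γ}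

/-- Every subset of `U` not covered by `p` good sets contains at most `c` vertices such that `p`
good sets cover the part of `U` anticomplete to them. -/
def AnticompleteCoverable (Good : Set γ → Prop) (p c : ℕ) (U : Set γ) (G : SimpleGraph γ) :
    Prop :=
  ∀ B ⊆ U, ¬ Coverable Good p B → ∃ K : Finset γ, ↑K ⊆ B ∧ K.card ≤ c ∧
    Coverable Good p {b ∈ U | ∀ a ∈ K, Gᶜ.Adj a b}

theorem AnticompleteCoverable.coverable_setOf_coverable_inter_neighborSet {m : ℕ}
    {G : SimpleGraph γ} (hG : Antitone Good) (hsub : ∀ X : Set γ, X.Subsingleton → Good X)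
    (hD : AnticompleteCoverable Good p c U G) {A B : Set γ} (hA : A ⊆ U) (hB : B ⊆ U)
    (hlarge : ¬ Coverable Good (c * (m + 1) + p) B) :
    Coverable Good p {a ∈ A | Coverable Good m (B ∩ G.neighborSet a)} := by
  by_contra hcon
  obtain ⟨K, hKA, hKc, hK⟩ := hD _ (fun a ha => hA ha.1) hcon
  have hcover : Coverable Good (K.card * (m + 1)) (⋃ a ∈ K, (B ∩ G.neighborSet a) ∪ {a}) :=
    Coverable.biUnion hG hsub K _ fun a ha =>
      (hKA ha).2.union hG (Coverable.of_good hG (hsub _ Set.subsingleton_singleton))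
  refine hlarge ((hcover.union hG hK).mono hG (by gcongr) fun b hb => ?_)
  by_cases hbK : ∀ a ∈ K, Gᶜ.Adj a b
  · exact Or.inr ⟨hB hb, hbK⟩
  · push Not at hbK
    obtain ⟨a, ha, hab⟩ := hbK
    rw [SimpleGraph.compl_adj] at hab
    refine Or.inl (Set.mem_biUnion ha ?_)
    by_cases hba : b = a
    · exact Or.inr hba
    · exact Or.inl ⟨hb, by_contra fun h => hab ⟨Ne.symm hba, h⟩⟩

/-- A number of good sets which, when it does not suffice to cover, forces all induced subgraphs
on `t` vertices. -/
def embeddingBound (p c : ℕ) : ℕ → ℕ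
  | 0 => 0
  | t + 1 => c * (embeddingBound p c t + 1) + p + t * (p + p)

theorem exists_embedding {G : SimpleGraph γ} (hG : Antitone Good)
    (hsub : ∀ X : Set γ, X.Subsingleton → Good X)
    (hD : AnticompleteCoverable Good p c U G) (hD' : AnticompleteCoverable Good p c U Gᶜ)
    (t : ℕ) (F : SimpleGraph (Fin t)) (A : Fin t → Set γ) (hA : ∀ i, A i ⊆ U)
    (hlarge : ∀ i, ¬ Coverable Good (embeddingBound p c t) (A i)) :
    ∃ f : Fin t → γ, (∀ i, f i ∈ A i) ∧ Function.Injective f ∧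
      ∀ i j, G.Adj (f i) (f j) ↔ F.Adj i j := by
  classical
  induction t with
  | zero => exact ⟨Fin.elim0, fun i => i.elim0, fun i => i.elim0, fun i => i.elim0⟩
  | succ t ih =>
    let M := embeddingBound p c t
    have hlarge' : ∀ i, ¬ Coverable Good (c * (M + 1) + p) (A i) := fun i h =>
      hlarge i (h.mono hG (Nat.le_add_right _ _) subset_rfl)
    have hcover := Coverable.biUnion hG hsub Finset.univ
      (fun j : Fin t => {a ∈ A 0 | Coverable Good M (A j.succ ∩ G.neighborSet a)} ∪
        {a ∈ A 0 | Coverable Good M (A j.succ ∩ Gᶜ.neighborSet a)})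
      (fun j _ => (hD.coverable_setOf_coverable_inter_neighborSet hG hsub (hA 0) (hA j.succ)
        (hlarge' _)).union hG
        (hD'.coverable_setOf_coverable_inter_neighborSet hG hsub (hA 0) (hA j.succ)
        (hlarge' _)))
    obtain ⟨a, ha, hagood⟩ : ∃ a ∈ A 0, ∀ j : Fin t,
        ¬ Coverable Good M (A j.succ ∩ G.neighborSet a) ∧
        ¬ Coverable Good M (A j.succ ∩ Gᶜ.neighborSet a) := by
      by_contra! hcon
      refine hlarge 0 (hcover.mono hG ?_ fun a ha => ?_)
      · simp only [embeddingBound, Finset.card_univ, Fintype.card_fin]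
        omega
      · by_contra hnot
        simp only [Set.mem_iUnion, Finset.mem_univ, Set.mem_union, Set.mem_ofPred_eq, not_exists,
          not_or, ha, true_and, exists_true_left] at hnot
        obtain ⟨j, hj⟩ := hcon a ha
        exact (hnot j).2 (hj (hnot j).1)
    obtain ⟨f, hfA, hfinj, hfadj⟩ := ih (F.comap Fin.succ)
      (fun j => A j.succ ∩
        if F.Adj 0 j.succ then G.neighborSet a else Gᶜ.neighborSet a)
      (fun j => Set.inter_subset_left.trans (hA _))
      (fun j => by
        by_cases h : F.Adj 0 j.succ
        · simpa only [h, if_true] using (hagood j).1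
        · simpa only [h, if_false] using (hagood j).2)
    have hne : ∀ j, f j ≠ a := by
      intro j hj
      have h := (hfA j).2
      rw [hj] at h
      split_ifs at h <;> simp at h
    have hadj : ∀ j, G.Adj a (f j) ↔ F.Adj 0 j.succ := by
      intro j
      have h := (hfA j).2
      split_ifs at h with hF
      · simpa [hF] using h
      · simp only [SimpleGraph.mem_neighborSet, SimpleGraph.compl_adj] at h
        simp [hF, h.2]
    refine ⟨Fin.cons a f, ?_, ?_, ?_⟩
    · exact Fin.cases ha fun j => (hfA j).1
    · rw [Fin.cons_injective_iff]
      exact ⟨by rintro ⟨j, hj⟩; exact hne j hj, hfinj⟩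
    · refine Fin.cases (Fin.cases (by simp) fun j => ?_) fun i => Fin.cases ?_ fun j => ?_
      · simpa using hadj j
      · simpa [G.adj_comm, F.adj_comm] using hadj i
      · simpa using hfadj i j

end Unavoidable

namespace EmbedsIn

variable {α γ : Type} {H : SimpleGraph α} {G : SimpleGraph γ}

theorem mono {s t : Set α} {A B : Set γ} (hst : s ⊆ t) (hAB : A ⊆ B)
    (h : EmbedsIn H G t A) : EmbedsIn H G s B := by
  obtain ⟨f, hfA, hinj, hadj⟩ := h
  exact ⟨fun x => f ⟨x, hst x.2⟩, fun x => hAB (hfA _),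
    fun x y hxy => Subtype.ext (congrArg Subtype.val (hinj hxy) :), fun x y => hadj _ _⟩

theorem of_compl {s : Set α} {A : Set γ} (h : EmbedsIn Hᶜ Gᶜ s A) : EmbedsIn H G s A := by
  obtain ⟨f, hfA, hinj, hadj⟩ := h
  refine ⟨f, hfA, hinj, fun x y => ?_⟩
  by_cases hxy : x = y
  · simp [hxy]
  · have h := hadj x y
    have hxy' : (x : α) ≠ y := fun h => hxy (Subtype.ext h)
    simp only [SimpleGraph.compl_adj, ne_eq, hinj.eq_iff, hxy, hxy', not_false_eq_true,
      true_and] at h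
    exact not_iff_not.mp h

theorem compl {s : Set α} {A : Set γ} (h : EmbedsIn H G s A) : EmbedsIn Hᶜ Gᶜ s A :=
  of_compl (by simpa using h)

theorem of_contains_induce {s : Set α} {A : Set γ} (h : Contains (G.induce A) (H.induce s)) :
    EmbedsIn H G s A := by
  obtain ⟨t, ⟨e⟩⟩ := h
  exact ⟨fun x => (e.symm x).1.1, fun x => (e.symm x).1.2,
    fun x y hxy => e.symm.injective (Subtype.ext (Subtype.ext hxy)),
    fun x y => e.symm.map_adj_iff (v := x) (w := y)⟩

theorem contains {A : Set γ} (h : EmbedsIn H G Set.univ A) : Contains G H := by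
  obtain ⟨f, -, hinj, hadj⟩ := h
  let g : α → γ := fun x => f ⟨x, trivial⟩
  have hg : Function.Injective g := fun x y hxy => congrArg Subtype.val (hinj hxy)
  refine ⟨Set.range g, ⟨(⟨Equiv.ofInjective g hg, ?_⟩ : H ≃g G.induce (Set.range g)).symm⟩⟩
  intro x y
  exact hadj ⟨x, trivial⟩ ⟨y, trivial⟩

variable {ι : Type} {κ : α → ι}

theorem of_anticomplete (hκ : ∀ x y, H.Adj x y → κ x = κ y) {i : ι} {S : Set ι} {A : Set γ}
    {f : κ ⁻¹' {i} → γ} (hfA : ∀ x, f x ∈ A) (hinj : Function.Injective f)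
    (hadj : ∀ x y, G.Adj (f x) (f y) ↔ H.Adj x y)
    (h : EmbedsIn H G (κ ⁻¹' S) {b ∈ A | ∀ x, Gᶜ.Adj (f x) b}) :
    EmbedsIn H G (κ ⁻¹' insert i S) A := by
  classical
  obtain ⟨g, hgA, hginj, hgadj⟩ := h
  have hS : ∀ x : κ ⁻¹' insert i S, κ x ≠ i → κ x ∈ S := fun x hx => x.2.resolve_left hx
  refine ⟨fun x => if hx : κ x = i then f ⟨x, hx⟩ else g ⟨x, hS x hx⟩, ?_, ?_, ?_⟩
  · intro x
    by_cases hx : κ x = i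
    · simpa only [hx, dif_pos] using hfA _
    · simpa only [hx, dif_neg, not_false_eq_true] using (hgA _).1
  · intro x y hxy
    by_cases hx : κ x = i <;> by_cases hy : κ y = i <;>
      simp only [hx, hy, dite_true, dite_false] at hxy
    · exact Subtype.ext (congrArg Subtype.val (hinj hxy) :)
    · exact absurd hxy ((hgA _).2 _).ne
    · exact absurd hxy.symm ((hgA _).2 _).ne
    · exact Subtype.ext (congrArg Subtype.val (hginj hxy) :)
  · intro x y
    by_cases hx : κ x = i <;> by_cases hy : κ y = i <;>
      simp only [hx, hy, dite_true, dite_false]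
    · exact hadj _ _
    · exact iff_of_false ((SimpleGraph.compl_adj ..).mp ((hgA _).2 _)).2
        fun h => hy ((hκ _ _ h).symm.trans hx)
    · exact iff_of_false (fun h => ((SimpleGraph.compl_adj ..).mp ((hgA _).2 _)).2 h.symm)
        fun h => hx ((hκ _ _ h).trans hy)
    · exact hgadj _ _

theorem anticompleteCoverable [Fintype α] (hκ : ∀ x y, H.Adj x y → κ x = κ y) {i : ι} {S : Set ι}
    {U : Set γ} {Good : Set γ → Prop} {p : ℕ} (hU : ¬ EmbedsIn H G (κ ⁻¹' insert i S) U)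
    (hi : ∀ B ⊆ U, ¬ EmbedsIn H G (κ ⁻¹' {i}) B → Coverable Good p B)
    (hS : ∀ B ⊆ U, ¬ EmbedsIn H G (κ ⁻¹' S) B → Coverable Good p B) :
    AnticompleteCoverable Good p (Fintype.card α) U G := by
  classical
  intro B hB hlarge
  obtain ⟨f, hfB, hinj, hadj⟩ : EmbedsIn H G (κ ⁻¹' {i}) B :=
    by_contra fun h => hlarge (hi B hB h)
  refine ⟨Finset.univ.image f, ?_, ?_, hS _ (fun b hb => hb.1) fun h => hU ?_⟩
  · simpa [Set.range_subset_iff] using hfB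
  · exact Finset.card_image_le.trans (Fintype.card_subtype_le _)
  · refine of_anticomplete hκ (fun x => hB (hfB x)) hinj hadj (h.mono subset_rfl ?_)
    exact fun b hb => ⟨hb.1, fun x => hb.2 _ (by simp)⟩

end EmbedsIn

section Partition

variable {α β ι ι' : Type} (H : SimpleGraph α) (L : SimpleGraph β) (κ : α → ι) (κ' : β → ι')

/-- `X` has at most one vertex, or misses some fibre of `κ` in `G`, or some fibre of `κ'` in the
complement of `G`. -/
def FibreFree {γ : Type} (G : SimpleGraph γ) (X : Set γ) : Prop :=
  X.Subsingleton ∨ (∃ i, ¬ EmbedsIn H G (κ ⁻¹' {i}) X) ∨ ∃ j, ¬ EmbedsIn L Gᶜ (κ' ⁻¹' {j}) X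

theorem fibreFree_antitone {γ : Type} (G : SimpleGraph γ) :
    Antitone (FibreFree H L κ κ' G) := by
  rintro X Y hXY (h | ⟨i, h⟩ | ⟨j, h⟩)
  · exact Or.inl (h.anti hXY)
  · exact Or.inr (Or.inl ⟨i, fun h' => h (h'.mono subset_rfl hXY)⟩)
  · exact Or.inr (Or.inr ⟨j, fun h' => h (h'.mono subset_rfl hXY)⟩)

theorem exists_coverable_fibreFree [Fintype α] [Fintype β]
    (hκ : ∀ x y, H.Adj x y → κ x = κ y) (hκ' : ∀ x y, L.Adj x y → κ' x = κ' y)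
    (S : Finset ι) (hS : S.Nonempty) (T : Finset ι') (hT : T.Nonempty) :
    ∃ P : ℕ, ∀ (γ : Type) (G : SimpleGraph γ) (U : Set γ),
      ¬ EmbedsIn H G (κ ⁻¹' S) U → ¬ EmbedsIn L Gᶜ (κ' ⁻¹' T) U →
        Coverable (FibreFree H L κ κ' G) P U := by
  induction hS using Finset.Nonempty.cons_induction generalizing T with
  | singleton i =>
    refine ⟨1, fun γ G U h _ => Coverable.of_good (fibreFree_antitone H L κ κ' G) ?_⟩
    exact Or.inr (Or.inl ⟨i, by simpa using h⟩)
  | cons i S hiS hS ihS =>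
    induction hT using Finset.Nonempty.cons_induction with
    | singleton j =>
      refine ⟨1, fun γ G U _ h => Coverable.of_good (fibreFree_antitone H L κ κ' G) ?_⟩
      exact Or.inr (Or.inr ⟨j, by simpa using h⟩)
    | cons j T hjT hT ihT =>
      obtain ⟨P₁, hP₁⟩ := ihS (Finset.cons j T hjT) (Finset.cons_nonempty hjT)
      obtain ⟨P₂, hP₂⟩ := ihT
      let p := P₁ + P₂ + 1
      let c := max (Fintype.card α) (Fintype.card β)
      refine ⟨embeddingBound p c (Fintype.card α), fun γ G U hHU hLU => ?_⟩
      have hanti := fibreFree_antitone H L κ κ' G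
      by_contra hlarge
      have hD : AnticompleteCoverable (FibreFree H L κ κ' G) p (Fintype.card α) U G := by
        refine EmbedsIn.anticompleteCoverable hκ (i := i) (S := S) (by simpa using hHU) ?_ ?_
        · exact fun B _ h => (Coverable.of_good hanti (Or.inr (Or.inl ⟨i, h⟩))).mono hanti
            (by omega) subset_rfl
        · exact fun B hB h => (hP₁ γ G B h fun h' => hLU (h'.mono subset_rfl hB)).mono hanti
            (by omega) subset_rfl
      have hD' : AnticompleteCoverable (FibreFree H L κ κ' G) p (Fintype.card β) U Gᶜ := by
        refine EmbedsIn.anticompleteCoverable hκ' (i := j) (S := T) (by simpa using hLU) ?_ ?_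
        · exact fun B _ h => (Coverable.of_good hanti (Or.inr (Or.inr ⟨j, h⟩))).mono hanti
            (by omega) subset_rfl
        · exact fun B hB h => (hP₂ γ G B (fun h' => hHU (h'.mono subset_rfl hB)) h).mono hanti
            (by omega) subset_rfl
      let e := Fintype.equivFin α
      obtain ⟨f, hfU, hinj, hadj⟩ := exists_embedding (c := c) hanti (fun X hX => Or.inl hX)
        (fun B hB h => (hD B hB h).imp fun K hK => ⟨hK.1, hK.2.1.trans (le_max_left _ _), hK.2.2⟩)
        (fun B hB h => (hD' B hB h).imp fun K hK => ⟨hK.1, hK.2.1.trans (le_max_right _ _), hK.2.2⟩)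
        (Fintype.card α) (H.comap e.symm) (fun _ => U) (fun _ => subset_rfl) (fun _ => hlarge)
      exact hHU ⟨fun x => f (e x), fun x => hfU _,
        fun x y hxy => Subtype.ext (e.injective (hinj hxy)), fun x y => by simp [hadj]⟩

end Partition

/-- Let `k ≥ 0` and let `H, J` be cographs of height `k+1` with `H` anticonnected and
`J` connected.  Then there exists `P > 0` such that every `{H,J}`-free graph admits a
`(c(H) ∪ ac(J), P)`-partition. -/
theorem stmt10 (k : ℕ) {α β : Type} [Fintype α] [Fintype β]
    (H : SimpleGraph α) (J : SimpleGraph β)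
    (hHheight : CographHeight H (k + 1)) (hJheight : CographHeight J (k + 1))
    (hHanti : Hᶜ.Connected) (hJconn : J.Connected) :
    ∃ P : ℕ, 0 < P ∧
      ∀ (γ : Type) [Fintype γ] (G : SimpleGraph γ), Free G H → Free G J →
        HasPartition P (fun X : Set γ =>
          (∃ c : H.ConnectedComponent, Free (G.induce X) (H.induce c.supp)) ∨
          (∃ c : Jᶜ.ConnectedComponent, Free (G.induce X) (J.induce c.supp))) := by
  classical
  let κ := H.connectedComponentMk
  let κ' := Jᶜ.connectedComponentMk
  obtain ⟨a⟩ := hHanti.nonempty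
  obtain ⟨b⟩ := hJconn.nonempty
  obtain ⟨P, hP⟩ := exists_coverable_fibreFree H Jᶜ κ κ'
    (fun x y h => SimpleGraph.ConnectedComponent.sound h.reachable)
    (fun x y h => SimpleGraph.ConnectedComponent.sound h.reachable)
    Finset.univ ⟨κ a, Finset.mem_univ _⟩ Finset.univ ⟨κ' b, Finset.mem_univ _⟩
  refine ⟨P + 1, P.succ_pos, fun γ _ G hGH hGJ => ?_⟩
  obtain ⟨f, hf, hgood⟩ := hP γ G Set.univ
    (fun h => hGH (EmbedsIn.contains (by simpa using h)))
    (fun h => hGJ (EmbedsIn.contains (EmbedsIn.of_compl (by simpa using h))))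
  refine ⟨fun i => {x | f x = i}, ?_, ?_, fun i => ?_⟩
  · refine Set.eq_univ_of_forall fun x => Set.mem_iUnion.mpr ?_
    exact ⟨⟨f x, (hf x trivial).trans P.lt_succ_self⟩, rfl⟩
  · intro i j hij
    refine Set.disjoint_left.mpr fun x hi hj => hij (Fin.ext ?_)
    exact (Set.mem_ofPred.mp hi).symm.trans hj
  · have hi := hgood i
    simp only [Set.mem_univ, true_and] at hi
    rcases hi with h | ⟨c, h⟩ | ⟨c, h⟩
    · rcases h.eq_empty_or_singleton with h | h
      · refine Or.inr (Or.inl ⟨κ a, fun hcon => ?_⟩)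
        obtain ⟨g, hg, -⟩ := EmbedsIn.of_contains_induce hcon
        exact (h.subset (hg ⟨a, rfl⟩)).elim
      · exact Or.inl h
    · exact Or.inr (Or.inl ⟨c, fun hcon => h (EmbedsIn.of_contains_induce hcon)⟩)
    · exact Or.inr (Or.inr ⟨c, fun hcon => h (EmbedsIn.of_contains_induce hcon).compl⟩)
end

section
/- If H_1 and H_2 are heroes (tournaments), then so is H_1 ⇒ H_2. -/
/-- A tournament on `V`: for every two distinct vertices exactly one of the two
directed edges is present, and there are no loops. -/
structure Tournament (V : Type) where
  adj : V → V → Prop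
  irrefl : ∀ v, ¬ adj v v
  exactlyOne : ∀ u v, u ≠ v → (adj u v ↔ ¬ adj v u)

/-- The subtournament induced on a subset `X` of the vertices. -/
def Tournament.induce {V : Type} (G : Tournament V) (X : Set V) : Tournament X where
  adj a b := G.adj a b
  irrefl v := G.irrefl v
  exactlyOne u v h := G.exactlyOne u v (fun hc => h (Subtype.ext hc))

/-- `G` contains `H` if `H` is isomorphic to a subtournament of `G`. -/
def TContains {α β : Type} (G : Tournament α) (H : Tournament β) : Prop :=
  ∃ f : β → α, Function.Injective f ∧ ∀ u v, H.adj u v ↔ G.adj (f u) (f v)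

/-- A set `X` is transitive in `G` if the subtournament induced on `X` has no directed
cycles, i.e. no vertex can reach itself by a nonempty directed walk inside `X`. -/
def TransitiveSet {α : Type} (G : Tournament α) (X : Set α) : Prop :=
  ∀ v, ¬ Relation.TransGen (fun a b => a ∈ X ∧ b ∈ X ∧ G.adj a b) v v

/-- The chromatic number of `G` is at most `c`: the vertex set can be partitioned into
`c` transitive subsets. -/
def TChromAtMost {α : Type} (G : Tournament α) (c : ℕ) : Prop :=
  ∃ f : α → Fin c, ∀ i, TransitiveSet G {v | f v = i}

/-- A tournament `H` is a hero if there exists `c` such that every `H`-free tournament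
has chromatic number at most `c`. -/
def Hero {β : Type} [Fintype β] (H : Tournament β) : Prop :=
  ∃ c : ℕ, ∀ (α : Type) [Fintype α] (G : Tournament α),
    ¬ TContains G H → TChromAtMost G c

/-- `H₁ ⇒ H₂`: the tournament on the disjoint union of the vertex sets in which every
vertex of `H₁` is adjacent to every vertex of `H₂`. -/
def TSeq {α β : Type} (H₁ : Tournament α) (H₂ : Tournament β) : Tournament (α ⊕ β) where
  adj x y := match x, y with
    | Sum.inl a, Sum.inl b => H₁.adj a b
    | Sum.inr a, Sum.inr b => H₂.adj a b
    | Sum.inl _, Sum.inr _ => True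
    | Sum.inr _, Sum.inl _ => False
  irrefl v := by cases v with
    | inl a => exact H₁.irrefl a
    | inr a => exact H₂.irrefl a
  exactlyOne u v h := by
    cases u with
    | inl a => cases v with
      | inl b => exact H₁.exactlyOne a b (fun hc => h (congrArg Sum.inl hc))
      | inr b => simp
    | inr a => cases v with
      | inl b => simp
      | inr b => exact H₂.exactlyOne a b (fun hc => h (congrArg Sum.inr hc))

/-- `X` can be covered by at most `n` transitive sets of `G`. -/
def TCover {V : Type} (G : Tournament V) (X : Set V) (n : ℕ) : Prop :=
  ∃ T : Finset (Set V), T.card ≤ n ∧ (∀ t ∈ T, TransitiveSet G t) ∧ ∀ x ∈ X, ∃ t ∈ T, x ∈ t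

/-- `f` embeds `H` into `G` as an induced subtournament. -/
def TCopy {V β : Type} (G : Tournament V) (H : Tournament β) (f : β → V) : Prop :=
  Function.Injective f ∧ ∀ u v, H.adj u v ↔ G.adj (f u) (f v)

/-- Every vertex set of a finite tournament without a copy of `H` is covered by `c`
transitive sets. -/
def TBound {β : Type} (H : Tournament β) (c : ℕ) : Prop :=
  ∀ (V : Type) [Fintype V] (G : Tournament V) (X : Set V),
    (¬ ∃ f : β → V, (∀ b, f b ∈ X) ∧ TCopy G H f) → TCover G X c

section Basic

variable {V : Type} {G : Tournament V}

lemma Tournament.asymm (G : Tournament V) {u v : V} (h : G.adj u v) : ¬ G.adj v u := by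
  have hne : u ≠ v := by rintro rfl; exact G.irrefl _ h
  exact (G.exactlyOne u v hne).1 h

lemma Tournament.total (G : Tournament V) {u v : V} (h : u ≠ v) : G.adj u v ∨ G.adj v u := by
  by_cases h' : G.adj v u
  · exact Or.inr h'
  · exact Or.inl ((G.exactlyOne u v h).2 h')

lemma TransitiveSet.mono {X Y : Set V} (h : TransitiveSet G Y) (hXY : X ⊆ Y) :
    TransitiveSet G X := fun v hv =>
  h v (Relation.TransGen.mono (fun _ _ hab => ⟨hXY hab.1, hXY hab.2.1, hab.2.2⟩) _ _ hv)

lemma transitiveSet_singleton (v : V) : TransitiveSet G {v} := by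
  intro u hu
  obtain ⟨w, hw, -⟩ := Relation.TransGen.head'_iff.1 hu
  obtain ⟨h₁, h₂, h⟩ := hw
  rw [Set.mem_singleton_iff] at h₁ h₂
  subst h₁ h₂
  exact G.irrefl _ h

lemma TransitiveSet.no_triangle {X : Set V} (h : TransitiveSet G X) {u v w : V}
    (hu : u ∈ X) (hv : v ∈ X) (hw : w ∈ X) (huv : G.adj u v) (hvw : G.adj v w) :
    ¬ G.adj w u := fun hwu =>
  h u (((Relation.TransGen.single ⟨hu, hv, huv⟩).tail ⟨hv, hw, hvw⟩).tail ⟨hw, hu, hwu⟩)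

lemma TCover.mono {X Y : Set V} {m n : ℕ} (h : TCover G Y m) (hXY : X ⊆ Y) (hmn : m ≤ n) :
    TCover G X n := by
  obtain ⟨T, h₁, h₂, h₃⟩ := h
  exact ⟨T, h₁.trans hmn, h₂, fun x hx => h₃ x (hXY hx)⟩

lemma TCover.union {X Y : Set V} {m n : ℕ} (hX : TCover G X m) (hY : TCover G Y n) :
    TCover G (X ∪ Y) (m + n) := by
  classical
  obtain ⟨T, h₁, h₂, h₃⟩ := hX
  obtain ⟨S, k₁, k₂, k₃⟩ := hY
  refine ⟨T ∪ S, (Finset.card_union_le _ _).trans (by omega), ?_, ?_⟩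
  · intro t ht
    exact (Finset.mem_union.1 ht).elim (h₂ t) (k₂ t)
  · rintro x (hx | hx)
    · obtain ⟨t, ht, hxt⟩ := h₃ x hx
      exact ⟨t, Finset.mem_union_left _ ht, hxt⟩
    · obtain ⟨t, ht, hxt⟩ := k₃ x hx
      exact ⟨t, Finset.mem_union_right _ ht, hxt⟩

lemma tCover_empty (n : ℕ) : TCover G ∅ n :=
  ⟨∅, by simp, by simp, by simp⟩

lemma tCover_singleton (v : V) : TCover G {v} 1 :=
  ⟨{{v}}, by simp, by simpa using transitiveSet_singleton v, by simp⟩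

lemma TCover.iUnion {ι : Type} [Fintype ι] {Y : ι → Set V} {n : ℕ}
    (h : ∀ i, TCover G (Y i) n) : TCover G (⋃ i, Y i) (Fintype.card ι * n) := by
  classical
  choose T h₁ h₂ h₃ using h
  refine ⟨Finset.univ.biUnion T, Finset.card_biUnion_le_card_mul _ _ _ fun i _ => h₁ i, ?_, ?_⟩
  · intro t ht
    obtain ⟨i, -, hi⟩ := Finset.mem_biUnion.1 ht
    exact h₂ i t hi
  · intro x hx
    obtain ⟨i, hi⟩ := Set.mem_iUnion.1 hx
    obtain ⟨t, ht, hxt⟩ := h₃ i x hi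
    exact ⟨t, Finset.mem_biUnion.2 ⟨i, Finset.mem_univ _, ht⟩, hxt⟩

lemma TCover.tChromAtMost {n : ℕ} (h : TCover G Set.univ n) : TChromAtMost G n := by
  obtain ⟨T, h₁, h₂, h₃⟩ := h
  choose t ht hvt using fun v => h₃ v (Set.mem_univ v)
  refine ⟨fun v => Fin.castLE h₁ (T.equivFin ⟨t v, ht v⟩), fun i u hu => ?_⟩
  have hui : Fin.castLE h₁ (T.equivFin ⟨t u, ht u⟩) = i := by
    obtain ⟨w, hw, -⟩ := Relation.TransGen.head'_iff.1 hu
    exact hw.1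
  refine (h₂ _ (ht u)).mono (X := {v | Fin.castLE h₁ (T.equivFin ⟨t v, ht v⟩) = i}) ?_ u hu
  intro v hv
  have hv' : Fin.castLE h₁ (T.equivFin ⟨t v, ht v⟩) = i := hv
  have h := T.equivFin.injective (Fin.castLE_injective h₁ (hv'.trans hui.symm))
  have h' : t v = t u := congrArg Subtype.val h
  exact h' ▸ hvt v

lemma TransitiveSet.image_val {X : Set V} {Y : Set X} (h : TransitiveSet (G.induce X) Y) :
    TransitiveSet G (Subtype.val '' Y) := by
  have key : ∀ a b : V, Relation.TransGen
      (fun a b => a ∈ Subtype.val '' Y ∧ b ∈ Subtype.val '' Y ∧ G.adj a b) a b →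
      ∃ (ha : a ∈ X) (hb : b ∈ X), Relation.TransGen
        (fun a b => a ∈ Y ∧ b ∈ Y ∧ (G.induce X).adj a b) ⟨a, ha⟩ ⟨b, hb⟩ := by
    intro a b hab
    induction hab with
    | single hab =>
      obtain ⟨⟨a, ha, rfl⟩, ⟨b, hb, rfl⟩, hab⟩ := hab
      exact ⟨a.2, b.2, .single ⟨ha, hb, hab⟩⟩
    | tail _ hbc ih =>
      obtain ⟨ha, hb, ih⟩ := ih
      obtain ⟨⟨b, hb', rfl⟩, ⟨c, hc, rfl⟩, hbc⟩ := hbc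
      exact ⟨ha, c.2, ih.tail ⟨hb', hc, hbc⟩⟩
  intro v hv
  obtain ⟨_, _, h'⟩ := key v v hv
  exact h _ h'

end Basic

lemma Hero.exists_tBound {β : Type} [Fintype β] {H : Tournament β} (h : Hero H) :
    ∃ c, TBound H c := by
  classical
  obtain ⟨c, hc⟩ := h
  refine ⟨c, fun V _ G X hX => ?_⟩
  have hfree : ¬ TContains (G.induce X) H := by
    rintro ⟨f, hf, hadj⟩
    exact hX ⟨fun b => f b, fun b => (f b).2, Subtype.val_injective.comp hf, hadj⟩
  obtain ⟨f, hf⟩ := hc X (G.induce X) hfree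
  refine ⟨Finset.univ.image fun i => Subtype.val '' {v | f v = i},
    Finset.card_image_le.trans (by simp), ?_, ?_⟩
  · intro t ht
    obtain ⟨i, -, rfl⟩ := Finset.mem_image.1 ht
    exact (hf i).image_val
  · intro x hx
    exact ⟨_, Finset.mem_image_of_mem _ (Finset.mem_univ (f ⟨x, hx⟩)), ⟨x, hx⟩, rfl, rfl⟩

section Seq

variable {α β : Type} {H₁ : Tournament α} {H₂ : Tournament β}

lemma TCopy.tContains_tSeq {V : Type} {G : Tournament V} {f : α → V} {g : β → V}
    (hf : TCopy G H₁ f) (hg : TCopy G H₂ g) (hfg : ∀ a b, G.adj (f a) (g b)) :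
    TContains G (TSeq H₁ H₂) := by
  refine ⟨Sum.elim f g, hf.1.sumElim hg.1 fun a b hab => ?_, ?_⟩
  · exact G.irrefl _ (hab ▸ hfg a b)
  · rintro (a | a) (b | b)
    · exact hf.2 a b
    · simpa [TSeq] using hfg a b
    · simpa [TSeq] using G.asymm (hfg b a)
    · exact hg.2 a b

variable {V : Type} [Fintype V] {G : Tournament V}

lemma TCopy.tCover_out {c : ℕ} {f : α → V} (hf : TCopy G H₁ f)
    (hG : ¬ TContains G (TSeq H₁ H₂)) (hc : TBound H₂ c) :
    TCover G {w | ∀ a, G.adj (f a) w} c := by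
  refine hc V G _ ?_
  rintro ⟨g, hg, hg'⟩
  exact hG (hf.tContains_tSeq hg' fun a b => hg b a)

lemma TCopy.tCover_in {c : ℕ} {g : β → V} (hg : TCopy G H₂ g)
    (hG : ¬ TContains G (TSeq H₁ H₂)) (hc : TBound H₁ c) :
    TCover G {w | ∀ b, G.adj w (g b)} c := by
  refine hc V G _ ?_
  rintro ⟨f, hf, hf'⟩
  exact hG (hf'.tContains_tSeq hg fun a b => hf a b)

lemma tCover_of_out [Fintype β] {c₁ c₂ D : ℕ} {X P : Set V}
    (hG : ¬ TContains G (TSeq H₁ H₂)) (h₁ : TBound H₁ c₁) (h₂ : TBound H₂ c₂)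
    (hPX : P ⊆ X) (hP : ∀ v ∈ P, TCover G {w ∈ X | G.adj v w} D) :
    TCover G P (c₂ + (c₁ + Fintype.card β * (1 + D))) := by
  by_cases h : ∃ g : β → V, (∀ b, g b ∈ P) ∧ TCopy G H₂ g
  · obtain ⟨g, hgP, hg⟩ := h
    refine ((hg.tCover_in hG h₁).union (TCover.iUnion fun b =>
      (tCover_singleton (g b)).union (hP _ (hgP b)))).mono ?_ (by omega)
    intro v hv
    by_cases hv' : ∀ b, G.adj v (g b)
    · exact Or.inl hv'
    · push Not at hv'
      obtain ⟨b, hb⟩ := hv'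
      refine Or.inr (Set.mem_iUnion.2 ⟨b, ?_⟩)
      by_cases hvb : v = g b
      · exact Or.inl hvb
      · exact Or.inr ⟨hPX hv, (G.total hvb).resolve_left hb⟩
  · exact (h₂ V G P h).mono subset_rfl (by omega)

lemma tCover_of_in [Fintype α] {c₁ c₂ D : ℕ} {X P : Set V}
    (hG : ¬ TContains G (TSeq H₁ H₂)) (h₁ : TBound H₁ c₁) (h₂ : TBound H₂ c₂)
    (hPX : P ⊆ X) (hP : ∀ v ∈ P, TCover G {w ∈ X | G.adj w v} D) :
    TCover G P (c₁ + (c₂ + Fintype.card α * (1 + D))) := by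
  by_cases h : ∃ f : α → V, (∀ a, f a ∈ P) ∧ TCopy G H₁ f
  · obtain ⟨f, hfP, hf⟩ := h
    refine ((hf.tCover_out hG h₂).union (TCover.iUnion fun a =>
      (tCover_singleton (f a)).union (hP _ (hfP a)))).mono ?_ (by omega)
    intro v hv
    by_cases hv' : ∀ a, G.adj (f a) v
    · exact Or.inl hv'
    · push Not at hv'
      obtain ⟨a, ha⟩ := hv'
      refine Or.inr (Set.mem_iUnion.2 ⟨a, ?_⟩)
      by_cases hva : v = f a
      · exact Or.inl hva
      · exact Or.inr ⟨hPX hv, (G.total hva).resolve_right ha⟩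
  · exact (h₁ V G P h).mono subset_rfl (by omega)

end Seq

/-- If the cyclic triangles of `Z` through any edge outside the symmetric relation `heavy` span a
set of small covering number, then subsets of `Z` without large `heavy`-cliques have bounded
covering number. -/
lemma exists_tCover_of_no_heavy_clique {α β : Type} [Fintype α] [Fintype β]
    {H₁ : Tournament α} {H₂ : Tournament β} {c₁ c₂ : ℕ} (h₁ : TBound H₁ c₁)
    (h₂ : TBound H₂ c₂) (m s : ℕ) :
    ∃ N, ∀ (V : Type) [Fintype V] (G : Tournament V), ¬ TContains G (TSeq H₁ H₂) →
      ∀ heavy : V → V → Prop, (∀ u v, heavy u v → heavy v u) →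
      ∀ Z : Set V,
      (∀ u v, G.adj u v → ¬ heavy u v → TCover G {w ∈ Z | G.adj v w ∧ G.adj w u} m) →
      ∀ X ⊆ Z, (∀ S : Finset V, (S : Set V) ⊆ X → (S : Set V).Pairwise heavy →
        S.card ≠ s) → TCover G X N := by
  classical
  induction s with
  | zero =>
    refine ⟨0, fun V _ G _ heavy _ Z _ X _ hX => ?_⟩
    exact absurd rfl (hX ∅ (by simp) (by simp))
  | succ s ih =>
    obtain ⟨N, hN⟩ := ih
    let D := c₂ + Fintype.card α * m + (c₁ + N)
    refine ⟨(c₂ + (c₁ + Fintype.card β * (1 + D))) + (c₁ + (c₂ + Fintype.card α * (1 + D))),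
      fun V _ G hG heavy hsymm Z hlight X hXZ hX => ?_⟩
    have hheavy : ∀ v ∈ X, TCover G {x ∈ X | x ≠ v ∧ heavy v x} N := by
      refine fun v hv => hN V G hG heavy hsymm Z hlight _ (fun x hx => hXZ hx.1) fun S hS hclique hcard => ?_
      have hvS : v ∉ S := fun h => (hS h).2.1 rfl
      refine hX (insert v S) ?_ ?_ (by rw [Finset.card_insert_of_notMem hvS, hcard])
      · rw [Finset.coe_insert]
        exact Set.insert_subset hv fun x hx => (hS hx).1
      · rw [Finset.coe_insert]
        exact hclique.insert fun x hx _ => ⟨(hS hx).2.2, hsymm _ _ (hS hx).2.2⟩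
    have hlocal : ∀ v ∈ X, TCover G {w ∈ X | G.adj v w} D ∨ TCover G {w ∈ X | G.adj w v} D := by
      intro v hv
      by_cases h : ∃ f : α → V, (∀ a, f a ∈ {w ∈ X | G.adj w v ∧ ¬ heavy v w}) ∧ TCopy G H₁ f
      · left
        obtain ⟨f, hfv, hf⟩ := h
        refine ((hf.tCover_out hG h₂).union (TCover.iUnion fun a =>
          hlight (f a) v (hfv a).2.1 fun h => (hfv a).2.2 (hsymm _ _ h))).mono ?_
          (by simp only [D]; omega)
        rintro w ⟨hwX, hw⟩
        by_cases hw' : ∀ a, G.adj (f a) w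
        · exact Or.inl hw'
        · push Not at hw'
          obtain ⟨a, ha⟩ := hw'
          refine Or.inr (Set.mem_iUnion.2 ⟨a, hXZ hwX, hw, (G.total ?_).resolve_right ha⟩)
          rintro rfl
          exact G.asymm hw (hfv a).2.1
      · right
        refine ((h₁ V G _ h).union (hheavy v hv)).mono ?_ (by simp only [D]; omega)
        rintro w ⟨hwX, hw⟩
        by_cases hh : heavy v w
        · exact Or.inr ⟨hwX, by rintro rfl; exact G.irrefl _ hw, hh⟩
        · exact Or.inl ⟨hwX, hw, hh⟩
    refine ((tCover_of_out (X := X) (P := {v ∈ X | TCover G {w ∈ X | G.adj v w} D})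
      hG h₁ h₂ (fun v hv => hv.1) fun v hv => hv.2).union
      (tCover_of_in (X := X) (P := {v ∈ X | TCover G {w ∈ X | G.adj w v} D})
      hG h₁ h₂ (fun v hv => hv.1) fun v hv => hv.2)).mono ?_ le_rfl
    intro v hv
    exact (hlocal v hv).imp (fun h => ⟨hv, h⟩) fun h => ⟨hv, h⟩

/-- In a tournament without `H₁ ⇒ H₂`, a vertex set of large covering number has a subset of
bounded size whose covering number exceeds `r`. -/
lemma exists_small_or_tCover {α β : Type} [Fintype α] [Fintype β]
    {H₁ : Tournament α} {H₂ : Tournament β} {c₁ c₂ : ℕ} (h₁ : TBound H₁ c₁)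
    (h₂ : TBound H₂ c₂) (r : ℕ) :
    ∃ k m, ∀ (V : Type) [Fintype V] (G : Tournament V), ¬ TContains G (TSeq H₁ H₂) →
      ∀ X : Set V, (∃ M : Finset V, (M : Set V) ⊆ X ∧ M.card ≤ k ∧ ¬ TCover G M r) ∨
        TCover G X m := by
  classical
  induction r with
  | zero =>
    refine ⟨1, 0, fun V _ G _ X => ?_⟩
    obtain rfl | ⟨x, hx⟩ := X.eq_empty_or_nonempty
    · exact Or.inr (tCover_empty 0)
    · refine Or.inl ⟨{x}, by simpa using hx, by simp, ?_⟩
      rintro ⟨T, hT, -, hcov⟩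
      obtain ⟨t, ht, -⟩ := hcov x (by simp)
      rw [Finset.card_eq_zero.1 (Nat.le_zero.1 hT)] at ht
      simp at ht
  | succ r ih =>
    obtain ⟨k, m, ih⟩ := ih
    obtain ⟨N, hN⟩ := exists_tCover_of_no_heavy_clique h₁ h₂ m (r + 2)
    refine ⟨(r + 2) + (r + 2) * (r + 2) * k, N, fun V _ G hG X => ?_⟩
    let heavy : V → V → Prop := fun u v => ∃ M : Finset V, (M : Set V) ⊆ X ∧ M.card ≤ k ∧
      ¬ TCover G M r ∧ ∀ t, TransitiveSet G t → u ∈ t → v ∈ t → ∀ w ∈ M, w ∉ t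
    by_cases hS : ∃ S : Finset V, (S : Set V) ⊆ X ∧ (S : Set V).Pairwise heavy ∧ S.card = r + 2
    · left
      obtain ⟨S, hSX, hclique, hcard⟩ := hS
      have hex : ∀ p : V × V, ∃ M : Finset V, (M : Set V) ⊆ X ∧ M.card ≤ k ∧
          (p.1 ∈ S → p.2 ∈ S → p.1 ≠ p.2 → ¬ TCover G M r ∧
            ∀ t, TransitiveSet G t → p.1 ∈ t → p.2 ∈ t → ∀ w ∈ M, w ∉ t) := by
        rintro ⟨u, v⟩
        by_cases h : u ∈ S ∧ v ∈ S ∧ u ≠ v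
        · obtain ⟨M, hMX, hMk, hM⟩ := hclique h.1 h.2.1 h.2.2
          exact ⟨M, hMX, hMk, fun _ _ _ => hM⟩
        · exact ⟨∅, by simp, by simp, fun hu hv huv => absurd ⟨hu, hv, huv⟩ h⟩
      choose M hMX hMk hM using hex
      refine ⟨S ∪ (S ×ˢ S).biUnion M, ?_, ?_, ?_⟩
      · intro x hx
        rcases Finset.mem_union.1 (Finset.mem_coe.1 hx) with hx | hx
        · exact hSX hx
        · obtain ⟨p, -, hp⟩ := Finset.mem_biUnion.1 hx
          exact hMX p hp
      · refine (Finset.card_union_le _ _).trans (Nat.add_le_add hcard.le ?_)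
        refine (Finset.card_biUnion_le_card_mul _ _ _ fun p _ => hMk p).trans ?_
        rw [Finset.card_product, hcard]
      · rintro ⟨T, hTcard, hT, hcov⟩
        choose! t ht hxt using fun x (hx : x ∈ S) => hcov x (by simp [hx])
        obtain ⟨u, hu, v, hv, huv, htuv⟩ := Finset.exists_ne_map_eq_of_card_lt_of_maps_to
          (by omega : T.card < S.card) ht
        obtain ⟨hMr, hMt⟩ := hM (u, v) hu hv huv
        refine hMr ⟨T.erase (t u), ?_, fun s hs => hT s (Finset.mem_of_mem_erase hs), ?_⟩
        · rw [Finset.card_erase_of_mem (ht u hu)]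
          omega
        · intro w hw
          obtain ⟨s, hs, hws⟩ := hcov w (Finset.mem_union_right _
            (Finset.mem_biUnion.2 ⟨(u, v), Finset.mk_mem_product hu hv, hw⟩))
          refine ⟨s, Finset.mem_erase.2 ⟨?_, hs⟩, hws⟩
          rintro rfl
          exact hMt _ (hT _ (ht u hu)) (hxt u hu) (htuv ▸ hxt v hv) w hw hws
    · right
      refine hN V G hG heavy ?_ X ?_ X subset_rfl fun S h h' h'' => hS ⟨S, h, h', h''⟩
      · rintro u v ⟨M, hMX, hMk, hMr, hM⟩
        exact ⟨M, hMX, hMk, hMr, fun t ht hv hu => hM t ht hu hv⟩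
      · intro u v huv hlight
        refine (ih V G hG _).resolve_left ?_
        rintro ⟨M, hMX, hMk, hMr⟩
        refine hlight ⟨M, fun w hw => (hMX hw).1, hMk, hMr, fun t ht hu hv w hw hwt => ?_⟩
        exact ht.no_triangle hu hv hwt huv (hMX hw).2.1 (hMX hw).2.2

theorem stmt11 {α β : Type} [Fintype α] [Fintype β]
    (H₁ : Tournament α) (H₂ : Tournament β) (h₁ : Hero H₁) (h₂ : Hero H₂) :
    Hero (TSeq H₁ H₂) := by
  classical
  obtain ⟨c₁, h₁⟩ := h₁.exists_tBound
  obtain ⟨c₂, h₂⟩ := h₂.exists_tBound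
  obtain ⟨k, m, hkm⟩ := exists_small_or_tCover h₁ h₂ (c₁ + c₂)
  refine ⟨m + (k + (k ^ Fintype.card α * c₂ + k ^ Fintype.card β * c₁)), fun V _ G hG => ?_⟩
  apply TCover.tChromAtMost
  obtain ⟨M, -, hMk, hM⟩ | hm := hkm V G hG Set.univ
  swap
  · exact hm.mono subset_rfl (by omega)
  have hout : ∀ f : α → M, TCover G
      {v | TCopy G H₁ (fun a => (f a : V)) ∧ ∀ a, G.adj (f a) v} c₂ := by
    intro f
    by_cases hf : TCopy G H₁ (fun a => (f a : V))
    · exact (hf.tCover_out hG h₂).mono (fun v hv => hv.2) le_rfl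
    · exact (tCover_empty c₂).mono (fun v hv => hf hv.1) le_rfl
  have hin : ∀ g : β → M, TCover G
      {v | TCopy G H₂ (fun b => (g b : V)) ∧ ∀ b, G.adj v (g b)} c₁ := by
    intro g
    by_cases hg : TCopy G H₂ (fun b => (g b : V))
    · exact (hg.tCover_in hG h₁).mono (fun v hv => hv.2) le_rfl
    · exact (tCover_empty c₁).mono (fun v hv => hg hv.1) le_rfl
  refine ((TCover.iUnion fun x : M => tCover_singleton (x : V)).union
    ((TCover.iUnion hout).union (TCover.iUnion hin))).mono ?_ ?_
  · intro v _
    by_cases hvM : v ∈ M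
    · exact Or.inl (Set.mem_iUnion.2 ⟨⟨v, hvM⟩, rfl⟩)
    right
    by_cases hf : ∃ f : α → V, (∀ a, f a ∈ {w | w ∈ M ∧ G.adj w v}) ∧ TCopy G H₁ f
    · obtain ⟨f, hfM, hf⟩ := hf
      exact Or.inl (Set.mem_iUnion.2 ⟨fun a => ⟨f a, (hfM a).1⟩, hf, fun a => (hfM a).2⟩)
    by_cases hg : ∃ g : β → V, (∀ b, g b ∈ {w | w ∈ M ∧ G.adj v w}) ∧ TCopy G H₂ g
    · obtain ⟨g, hgM, hg⟩ := hg
      exact Or.inr (Set.mem_iUnion.2 ⟨fun b => ⟨g b, (hgM b).1⟩, hg, fun b => (hgM b).2⟩)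
    refine absurd (((h₁ V G _ hf).union (h₂ V G _ hg)).mono ?_ le_rfl) hM
    intro w hw
    have hwv : w ≠ v := by rintro rfl; exact hvM hw
    exact (G.total hwv).imp (fun h => ⟨hw, h⟩) fun h => ⟨hw, h⟩
  · simp only [Fintype.card_fun, Fintype.card_coe, mul_one]
    refine (Nat.add_le_add hMk (Nat.add_le_add ?_ ?_)).trans (Nat.le_add_left _ _)
    · exact Nat.mul_le_mul_right _ (Nat.pow_le_pow_left hMk _)
    · exact Nat.mul_le_mul_right _ (Nat.pow_le_pow_left hMk _)
end

section
/- Let k_1,…,k_s be integers each at least 2, and let r ≥ 2 be an integer. Then for all sufficiently large n there exists a finite vertex set V with |V| = n and a hypergraph H on V whose hyperedges are assigned labels from {1,…,s}, with every hyperedge of label i having exactly k_i vertices, such that: (i) H has no cycle of length t for any 2 ≤ t ≤ r; and (ii) every subset of V of size at least n/log n contains, for each i ∈ {1,…,s}, a hyperedge of label i. -/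
/-- `HypCycle E t` says the hypergraph with hyperedge set `E` has a cycle of length `t`:
for `t = 2`, a pair of distinct vertices contained in two distinct hyperedges;
for `t ≥ 3`, a sequence of distinct vertices `v_0, …, v_{t-1}` (indexed cyclically by
`ZMod t`) such that for each `i` some hyperedge meets `{v_0,…,v_{t-1}}` exactly in
`{v_i, v_{i+1}}`. -/
def HypCycle {V : Type} (E : Set (Finset V)) (t : ℕ) : Prop :=
  (t = 2 ∧ ∃ u v : V, u ≠ v ∧ ∃ A ∈ E, ∃ B ∈ E, A ≠ B ∧
      u ∈ A ∧ v ∈ A ∧ u ∈ B ∧ v ∈ B) ∨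
  (3 ≤ t ∧ ∃ f : ZMod t → V, Function.Injective f ∧
      ∀ i : ZMod t, ∃ A ∈ E, (↑A : Set V) ∩ Set.range f = {f i, f (i + 1)})

open Finset in
/-- If every member of a nonempty family has at least `q * |V|` points outside `X`, then some point
outside `X` belongs to a proportion at least `q` of the family. -/
theorem exists_notMem_card_filter_mem_ge {V : Type} [Fintype V] [DecidableEq V]
    [Nonempty V] {F : Finset (Finset V)} (hF : F.Nonempty) {X : Finset V} {q : ℝ} (hq : 0 < q)
    (h : ∀ S ∈ F, q * Fintype.card V + #X ≤ #S) :
    ∃ v ∉ X, q * #F ≤ #{S ∈ F | v ∈ S} := by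
  by_contra! hcon
  obtain ⟨S₀, hS₀⟩ := hF
  have hle : (#S₀ : ℝ) ≤ Fintype.card V := by exact_mod_cast card_le_univ S₀
  have hdc : ∑ v ∈ Xᶜ, #{S ∈ F | v ∈ S} = ∑ S ∈ F, #(S \ X) := by
    simp only [card_filter]
    rw [sum_comm]
    refine sum_congr rfl fun S _ => ?_
    rw [← card_filter]
    congr 1
    ext v
    simp [and_comm]
  have hlow : (#F : ℝ) * (q * Fintype.card V) ≤ ∑ S ∈ F, (#(S \ X) : ℝ) := by
    rw [← nsmul_eq_mul]
    refine card_nsmul_le_sum _ _ _ fun S hS => ?_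
    have h1 := h S hS
    have h2 : (#S : ℝ) ≤ #(S \ X) + #X := by exact_mod_cast card_le_card_sdiff_add_card
    linarith
  have hne : (Xᶜ).Nonempty := by
    by_contra hemp
    rw [not_nonempty_iff_eq_empty, compl_eq_empty_iff] at hemp
    have h1 := h S₀ hS₀
    rw [hemp, card_univ] at h1
    have : (0 : ℝ) < q * Fintype.card V := by positivity
    linarith
  have hup : ∑ v ∈ Xᶜ, (#{S ∈ F | v ∈ S} : ℝ) < ∑ _v ∈ Xᶜ, q * #F :=
    sum_lt_sum_of_nonempty hne fun v hv => hcon v (by simpa using hv)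
  rw [sum_const, nsmul_eq_mul] at hup
  have hc : (#Xᶜ : ℝ) * (q * #F) ≤ Fintype.card V * (q * #F) := by
    gcongr
    exact_mod_cast card_le_univ _
  have : (∑ v ∈ Xᶜ, (#{S ∈ F | v ∈ S} : ℝ)) = ∑ S ∈ F, (#(S \ X) : ℝ) := by exact_mod_cast hdc
  nlinarith

open Finset in
/-- A family of large sets has a dense subfamily containing a common `k`-set which avoids `X` and
whose points are pairwise separated by a symmetric neighbourhood system `b`. -/
theorem exists_separated_card_filter_subset_ge {V : Type} [Fintype V] [DecidableEq V] [Nonempty V]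
    {F : Finset (Finset V)} (hF : F.Nonempty) {X : Finset V} {q : ℝ} (hq : 0 < q)
    {b : V → Finset V} (hself : ∀ v, v ∈ b v) (hsymm : ∀ u v, v ∈ b u → u ∈ b v)
    {B : ℕ} (hB : ∀ v, #(b v) ≤ B) (k : ℕ)
    (h : ∀ S ∈ F, q * Fintype.card V + #X + k * B ≤ #S) :
    ∃ A : Finset V, #A = k ∧ Disjoint A X ∧ (∀ u ∈ A, ∀ v ∈ A, u ≠ v → v ∉ b u) ∧
      q ^ k * #F ≤ #{S ∈ F | A ⊆ S} := by
  induction k with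
  | zero => exact ⟨∅, by simp⟩
  | succ k ih =>
    obtain ⟨A, hA, hAX, hsep, hden⟩ := ih fun S hS => by
      have h1 := h S hS
      push_cast at h1
      have : (0 : ℝ) ≤ B := by positivity
      linarith
    have hpos : (0 : ℝ) < #{S ∈ F | A ⊆ S} :=
      lt_of_lt_of_le (mul_pos (pow_pos hq k) (by exact_mod_cast hF.card_pos)) hden
    have hne : ({S ∈ F | A ⊆ S} : Finset _).Nonempty := card_pos.mp (by exact_mod_cast hpos)
    obtain ⟨v, hv, hvd⟩ := exists_notMem_card_filter_mem_ge hne (X := X ∪ A.biUnion b) hq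
      fun S hS => by
        have h1 := h S (mem_of_mem_filter S hS)
        have h2 : #(X ∪ A.biUnion b) ≤ #X + k * B :=
          (card_union_le _ _).trans (Nat.add_le_add_left
            (hA ▸ card_biUnion_le_card_mul _ _ _ fun v _ => hB v) _)
        have h3 : (#(X ∪ A.biUnion b) : ℝ) ≤ #X + k * B := by exact_mod_cast h2
        push_cast at h1
        have : (0 : ℝ) ≤ B := by positivity
        linarith
    simp only [mem_union, mem_biUnion, not_or, not_exists, not_and] at hv
    have hvA : v ∉ A := fun hmem => hv.2 v hmem (hself v)
    refine ⟨insert v A, by rw [card_insert_of_notMem hvA, hA], ?_, ?_, ?_⟩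
    · rw [disjoint_insert_left]
      exact ⟨hv.1, hAX⟩
    · intro u hu w hw huw
      rw [mem_insert] at hu hw
      rcases hu with rfl | hu <;> rcases hw with rfl | hw
      · exact absurd rfl huw
      · exact fun hmem => hv.2 w hw (hsymm _ _ hmem)
      · exact hv.2 u hu
      · exact hsep u hu w hw huw
    · have heq : ({S ∈ {S ∈ F | A ⊆ S} | v ∈ S} : Finset _) = {S ∈ F | insert v A ⊆ S} := by
        ext S
        simp only [mem_filter, insert_subset_iff]
        tauto
      rw [heq] at hvd
      calc q ^ (k + 1) * (#F : ℝ) = q * (q ^ k * #F) := by ring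
        _ ≤ q * #{S ∈ F | A ⊆ S} := by gcongr
        _ ≤ _ := hvd

/-- The set consisting of `u` and all vertices sharing a hyperedge of `E` with `u`. -/
def hypNbhd {V : Type} [DecidableEq V] (E : Finset (Finset V)) (u : V) : Finset V :=
  insert u ((E.filter (u ∈ ·)).biUnion id)

/-- The set of vertices at distance at most `j` from `u` in the hypergraph `E`. -/
def hypBall {V : Type} [DecidableEq V] (E : Finset (Finset V)) : ℕ → V → Finset V
  | 0, u => {u}
  | j + 1, u => (hypBall E j u).biUnion (hypNbhd E)

section Ball

variable {V : Type} [DecidableEq V] {E : Finset (Finset V)}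

theorem mem_hypNbhd {u v : V} : v ∈ hypNbhd E u ↔ v = u ∨ ∃ A ∈ E, u ∈ A ∧ v ∈ A := by
  simp [hypNbhd, and_assoc]

theorem hypNbhd_symm {u v : V} (h : v ∈ hypNbhd E u) : u ∈ hypNbhd E v := by
  rw [mem_hypNbhd] at h ⊢
  rcases h with rfl | ⟨A, hA, hu, hv⟩
  · exact Or.inl rfl
  · exact Or.inr ⟨A, hA, hv, hu⟩

theorem mem_hypBall_succ {j : ℕ} {u v : V} :
    v ∈ hypBall E (j + 1) u ↔ ∃ w ∈ hypBall E j u, v ∈ hypNbhd E w := by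
  simp [hypBall]

theorem mem_hypBall_succ' {j : ℕ} {u v : V} :
    v ∈ hypBall E (j + 1) u ↔ ∃ w ∈ hypNbhd E u, v ∈ hypBall E j w := by
  induction j generalizing v with
  | zero => simp [hypBall]
  | succ j ih =>
    rw [mem_hypBall_succ]
    constructor
    · rintro ⟨w, hw, hv⟩
      obtain ⟨x, hx, hwx⟩ := ih.mp hw
      exact ⟨x, hx, mem_hypBall_succ.mpr ⟨w, hwx, hv⟩⟩
    · rintro ⟨x, hx, hv⟩
      obtain ⟨w, hw, hvw⟩ := mem_hypBall_succ.mp hv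
      exact ⟨w, ih.mpr ⟨x, hx, hw⟩, hvw⟩

theorem hypBall_symm {j : ℕ} {u v : V} (h : v ∈ hypBall E j u) : u ∈ hypBall E j v := by
  induction j generalizing u v with
  | zero => simpa [hypBall, eq_comm] using h
  | succ j ih =>
    obtain ⟨w, hw, hv⟩ := mem_hypBall_succ.mp h
    exact mem_hypBall_succ'.mpr ⟨w, hypNbhd_symm hv, ih hw⟩

theorem hypBall_mono {i j : ℕ} (hij : i ≤ j) (u : V) : hypBall E i u ⊆ hypBall E j u := by
  induction hij with
  | refl => exact subset_rfl
  | step _ ih =>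
    exact ih.trans fun v hv => mem_hypBall_succ.mpr ⟨v, hv, mem_hypNbhd.mpr (Or.inl rfl)⟩

theorem self_mem_hypBall (j : ℕ) (u : V) : u ∈ hypBall E j u :=
  hypBall_mono (Nat.zero_le j) u (Finset.mem_singleton_self u)

open Finset in
theorem card_hypBall_le {K D : ℕ} (hK : ∀ A ∈ E, #A ≤ K) (hD : ∀ v, #{A ∈ E | v ∈ A} ≤ D)
    (j : ℕ) (u : V) : #(hypBall E j u) ≤ (D * K + 1) ^ j := by
  have hN : ∀ v, #(hypNbhd E v) ≤ D * K + 1 := fun v =>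
    (card_insert_le _ _).trans (Nat.add_le_add_right
      ((card_biUnion_le_card_mul _ _ K fun A hA => hK A (mem_of_mem_filter A hA)).trans
        (Nat.mul_le_mul_right K (hD v))) 1)
  induction j with
  | zero => simp [hypBall]
  | succ j ih =>
    calc #(hypBall E (j + 1) u) ≤ #(hypBall E j u) * (D * K + 1) :=
          card_biUnion_le_card_mul _ _ _ fun v _ => hN v
      _ ≤ (D * K + 1) ^ (j + 1) := by
          rw [pow_succ]
          exact Nat.mul_le_mul_right _ ih

/-- Adding a hyperedge whose vertices are pairwise at distance more than `r` creates no cycle of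
length at most `r`. -/
theorem not_hypCycle_insert {r : ℕ} (hr : 1 ≤ r) {A : Finset V}
    (hA : ∀ u ∈ A, ∀ v ∈ A, u ≠ v → v ∉ hypBall E r u) {t : ℕ} (ht : t ≤ r)
    (hE : ¬ HypCycle (E : Set (Finset V)) t) :
    ¬ HypCycle (↑(insert A E) : Set (Finset V)) t := by
  have hpair : ∀ u ∈ A, ∀ v ∈ A, u ≠ v → ∀ C ∈ E, u ∈ C → v ∉ C := fun u hu v hv huv C hC huC hvC =>
    hA u hu v hv huv (hypBall_mono hr u (mem_hypBall_succ.mpr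
      ⟨u, self_mem_hypBall 0 u, mem_hypNbhd.mpr (Or.inr ⟨C, hC, huC, hvC⟩)⟩))
  rintro (⟨rfl, u, v, huv, C, hC, D, hD, hCD, huC, hvC, huD, hvD⟩ | ⟨ht3, f, hf, hcyc⟩)
  · rw [Finset.mem_coe, Finset.mem_insert] at hC hD
    rcases hC with rfl | hC <;> rcases hD with rfl | hD
    · exact hCD rfl
    · exact hpair u huC v hvC huv D hD huD hvD
    · exact hpair u huD v hvD huv C hC huC hvC
    · exact hE (Or.inl ⟨rfl, u, v, huv, C, hC, D, hD, hCD, huC, hvC, huD, hvD⟩)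
  · choose g hg hgf using hcyc
    by_cases hall : ∀ i, g i ∈ E
    · exact hE (Or.inr ⟨ht3, f, hf, fun i => ⟨g i, hall i, hgf i⟩⟩)
    push Not at hall
    obtain ⟨i₀, hi₀⟩ := hall
    have hgmem : ∀ i, g i = A ∨ g i ∈ E := fun i => by
      simpa only [Finset.mem_coe, Finset.mem_insert] using hg i
    have hgi₀ : g i₀ = A := (hgmem i₀).resolve_right hi₀
    have hl : ∀ i, f i ∈ g i := fun i =>
      ((hgf i).symm.subset (Set.mem_insert _ _)).1
    have hrr : ∀ i, f (i + 1) ∈ g i := fun i =>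
      ((hgf i).symm.subset (Set.mem_insert_of_mem _ rfl)).1
    have hone : ∀ m : ℕ, 0 < m → m < t → (m : ZMod t) ≠ 0 := fun m hm hmt h0 =>
      absurd (Nat.le_of_dvd hm ((ZMod.natCast_eq_zero_iff m t).mp h0)) (by omega)
    have huniq : ∀ i, i ≠ i₀ → g i ∈ E := fun i hi => by
      refine (hgmem i).resolve_left fun hgi => ?_
      have heq : ({f i, f (i + 1)} : Set V) = {f i₀, f (i₀ + 1)} := by
        rw [← hgf i, ← hgf i₀, hgi, hgi₀]
      have h1 : f i ∈ ({f i₀, f (i₀ + 1)} : Set V) := heq ▸ Set.mem_insert _ _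
      have h2 : f (i + 1) ∈ ({f i₀, f (i₀ + 1)} : Set V) :=
        heq ▸ Set.mem_insert_of_mem _ rfl
      have e1 : i = i₀ + 1 := (h1.resolve_left fun h => hi (hf h)) |> fun h => hf h
      rcases h2 with h2 | h2
      · have e2 := hf h2
        refine hone 2 (by norm_num) (by omega) ?_
        rw [e1] at e2
        push_cast
        linear_combination e2
      · have e2 := hf h2
        exact hi (add_right_cancel e2)
    have hchain : ∀ j : ℕ, j < t → f (i₀ + 1 + j) ∈ hypBall E j (f (i₀ + 1)) := by
      intro j
      induction j with
      | zero => intro _; simp [hypBall]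
      | succ j ih =>
        intro hj
        refine mem_hypBall_succ.mpr ⟨_, ih (by omega), mem_hypNbhd.mpr (Or.inr
          ⟨g (i₀ + 1 + j), huniq _ fun h => ?_, hl _, ?_⟩)⟩
        · refine hone (j + 1) (by omega) hj ?_
          push_cast
          linear_combination h
        · have := hrr (i₀ + 1 + j)
          push_cast
          rwa [add_assoc _ (j : ZMod t) 1] at this
    have hlast := hchain (t - 1) (by omega)
    have hwrap : i₀ + 1 + ((t - 1 : ℕ) : ZMod t) = i₀ := by
      rw [Nat.cast_sub (by omega)]
      simp
    rw [hwrap] at hlast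
    refine hA (f (i₀ + 1)) (hgi₀ ▸ hrr i₀) (f i₀) (hgi₀ ▸ hl i₀) (fun h => ?_)
      (hypBall_mono (by omega) _ hlast)
    refine hone 1 one_pos (by omega) ?_
    have := hf h
    push_cast
    linear_combination this

end Ball

/-- A hypergraph `E` labelled by `lab` in which a hyperedge of label `i` has `k i` vertices, no
cycle has length between `2` and `r`, and every vertex has degree at most `D`. -/
structure IsSparseLabelled {V : Type} [DecidableEq V] {s : ℕ} (k : Fin s → ℕ) (r D : ℕ)
    (E : Finset (Finset V)) (lab : Finset V → Fin s) : Prop where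
  card_eq : ∀ A ∈ E, A.card = k (lab A)
  not_cycle : ∀ t, 2 ≤ t → t ≤ r → ¬ HypCycle (E : Set (Finset V)) t
  degree_le : ∀ v, (E.filter (v ∈ ·)).card ≤ D

/-- The members of `F` that contain no hyperedge of label `i`. -/
def missedSets {V : Type} [DecidableEq V] {s : ℕ} (F : Finset (Finset V))
    (E : Finset (Finset V)) (lab : Finset V → Fin s) (i : Fin s) : Finset (Finset V) :=
  F.filter fun S => ¬ ∃ A ∈ E, lab A = i ∧ A ⊆ S

section Greedy

open Finset

variable {V : Type} [DecidableEq V] {E : Finset (Finset V)}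

theorem IsSparseLabelled.insert_update {s r D : ℕ} {k : Fin s → ℕ} (hr : 1 ≤ r)
    {lab : Finset V → Fin s} (h : IsSparseLabelled k r D E lab) {A : Finset V} (hAE : A ∉ E)
    {i : Fin s} (hAi : #A = k i) (hsep : ∀ u ∈ A, ∀ v ∈ A, u ≠ v → v ∉ hypBall E r u)
    (hdeg : ∀ v ∈ A, #{C ∈ E | v ∈ C} < D) :
    IsSparseLabelled k r D (insert A E) (Function.update lab A i) where
  card_eq C hC := by
    obtain rfl | hCA := eq_or_ne C A
    · simpa using hAi
    · rw [Function.update_of_ne hCA]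
      exact h.card_eq C ((mem_insert.mp hC).resolve_left hCA)
  not_cycle t ht htr := not_hypCycle_insert hr hsep htr (h.not_cycle t ht htr)
  degree_le v := by
    rw [filter_insert]
    split_ifs with hv
    · exact (card_insert_le _ _).trans (hdeg v hv)
    · exact h.degree_le v

variable [Fintype V]

theorem card_filter_degree_ge_le {K D x : ℕ} (hD : 0 < D) (hK : ∀ A ∈ E, #A ≤ K)
    (hx : #E * K ≤ x * D) : #{v : V | D ≤ #{A ∈ E | v ∈ A}} ≤ x := by
  refine Nat.le_of_mul_le_mul_right (le_trans ?_ hx) hD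
  calc #{v : V | D ≤ #{A ∈ E | v ∈ A}} * D
      ≤ ∑ v with D ≤ #{A ∈ E | v ∈ A}, #{A ∈ E | v ∈ A} :=
        card_nsmul_le_sum _ _ _ fun v hv => (mem_filter.mp hv).2
    _ ≤ ∑ v, #{A ∈ E | v ∈ A} := sum_le_sum_of_subset (filter_subset _ _)
    _ = ∑ A ∈ E, #A := by
        simp only [card_filter]
        rw [sum_comm]
        refine sum_congr rfl fun A _ => ?_
        rw [← card_filter]
        congr 1
        ext v
        simp
    _ ≤ #E * K := sum_le_card_nsmul _ _ _ hK

theorem IsSparseLabelled.exists_sum_card_missedSets_le [Nonempty V] {s r D K x : ℕ}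
    {k : Fin s → ℕ} (hk2 : ∀ i, 2 ≤ k i) (hkK : ∀ i, k i ≤ K) (hr : 1 ≤ r) (hD : 0 < D)
    {lab : Finset V → Fin s} (h : IsSparseLabelled k r D E lab) (hx : #E * K ≤ x * D)
    {F : Finset (Finset V)} {q : ℝ} (hq : 0 < q) (hq1 : q ≤ 1)
    (hF : ∀ S ∈ F, q * Fintype.card V + x + K * ((D * K + 1) ^ r : ℕ) ≤ #S) :
    ∃ (E' : Finset (Finset V)) (lab' : Finset V → Fin s), IsSparseLabelled k r D E' lab' ∧
      #E' ≤ #E + 1 ∧ ((∑ i, #(missedSets F E' lab' i) : ℕ) : ℝ) ≤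
        (1 - q ^ K / (s + 1)) * ((∑ i, #(missedSets F E lab i) : ℕ) : ℝ) := by
  by_cases h0 : ∑ i, #(missedSets F E lab i) = 0
  · exact ⟨E, lab, h, Nat.le_succ _, by rw [h0, Nat.cast_zero, mul_zero]⟩
  obtain ⟨i, hi⟩ : ∃ i, ∑ j, #(missedSets F E lab j) ≤ (s + 1) * #(missedSets F E lab i) := by
    by_contra! hcon
    have h1 := sum_le_sum fun i (_ : i ∈ univ) => (hcon i).le
    rw [← mul_sum, sum_const, card_univ, Fintype.card_fin, smul_eq_mul] at h1
    have := Nat.pos_of_ne_zero h0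
    nlinarith
  have hne : (missedSets F E lab i).Nonempty := by
    rw [nonempty_iff_ne_empty]
    rintro he
    rw [he] at hi
    exact h0 (by simpa using hi)
  have hEK : ∀ A ∈ E, #A ≤ K := fun A hA => (h.card_eq A hA).trans_le (hkK _)
  obtain ⟨A, hAi, hAX, hsep, hden⟩ := exists_separated_card_filter_subset_ge hne
    (X := {v : V | D ≤ #{A ∈ E | v ∈ A}}) hq (self_mem_hypBall r) (fun u v => hypBall_symm)
    (card_hypBall_le hEK h.degree_le r) (k i) fun S hS => by
      have h1 := hF S (mem_of_mem_filter S hS)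
      have h2 : (#{v : V | D ≤ #{A ∈ E | v ∈ A}} : ℝ) ≤ x := by
        exact_mod_cast card_filter_degree_ge_le hD hEK hx
      have h3 : (k i : ℝ) * ((D * K + 1) ^ r : ℕ) ≤ K * ((D * K + 1) ^ r : ℕ) := by
        gcongr
        exact hkK i
      linarith
  have hAE : A ∉ E := fun hmem => by
    obtain ⟨u, hu, v, hv, huv⟩ := one_lt_card.mp ((hk2 i).trans_eq hAi.symm)
    exact hsep u hu v hv huv (hypBall_mono hr u (mem_hypBall_succ.mpr
      ⟨u, self_mem_hypBall 0 u, mem_hypNbhd.mpr (Or.inr ⟨A, hmem, hu, hv⟩)⟩))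
  refine ⟨insert A E, Function.update lab A i, h.insert_update hr hAE hAi hsep fun v hv => ?_,
    card_insert_le _ _, ?_⟩
  · have := disjoint_left.mp hAX hv
    simpa using this
  have hmono : ∀ j, missedSets F (insert A E) (Function.update lab A i) j ⊆
      missedSets F E lab j := fun j S hS => by
    simp only [missedSets, mem_filter] at hS ⊢
    refine ⟨hS.1, fun ⟨C, hC, hCj, hCS⟩ => hS.2 ⟨C, mem_insert_of_mem hC, ?_, hCS⟩⟩
    rwa [Function.update_of_ne (ne_of_mem_of_not_mem hC hAE)]
  have hcard : ∀ j, #(missedSets F (insert A E) (Function.update lab A i) j) +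
      (if j = i then #{S ∈ missedSets F E lab i | A ⊆ S} else 0) ≤ #(missedSets F E lab j) := by
    intro j
    split_ifs with hji
    · subst hji
      rw [← card_union_of_disjoint]
      · exact card_le_card (union_subset (hmono j) (filter_subset _ _))
      · rw [disjoint_left]
        intro S hS hS'
        exact (mem_filter.mp hS).2
          ⟨A, mem_insert_self _ _, Function.update_self _ _ _, (mem_filter.mp hS').2⟩
    · exact card_le_card (hmono j)
  have hsum := sum_le_sum fun j (_ : j ∈ univ) => hcard j
  rw [sum_add_distrib, sum_ite_eq' univ i, if_pos (mem_univ i)] at hsum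
  have hsum' : ((∑ j, #(missedSets F (insert A E) (Function.update lab A i) j) : ℕ) : ℝ) +
      #{S ∈ missedSets F E lab i | A ⊆ S} ≤ ((∑ j, #(missedSets F E lab j) : ℕ) : ℝ) := by
    exact_mod_cast hsum
  have hi' : ((∑ j, #(missedSets F E lab j) : ℕ) : ℝ) ≤ (s + 1) * #(missedSets F E lab i) := by
    exact_mod_cast hi
  have hqk : q ^ K ≤ q ^ k i := pow_le_pow_of_le_one hq.le hq1 (hkK i)
  have hfin : q ^ K / (s + 1) * ((∑ j, #(missedSets F E lab j) : ℕ) : ℝ) ≤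
      #{S ∈ missedSets F E lab i | A ⊆ S} := by
    calc q ^ K / (s + 1) * ((∑ j, #(missedSets F E lab j) : ℕ) : ℝ)
        ≤ q ^ K / (s + 1) * ((s + 1) * #(missedSets F E lab i)) := by gcongr
      _ = q ^ K * #(missedSets F E lab i) := by field_simp
      _ ≤ q ^ k i * #(missedSets F E lab i) := by gcongr
      _ ≤ _ := hden
  linarith

theorem exists_isSparseLabelled_sum_card_missedSets_le [Nonempty V] {s r D K x J : ℕ}
    [NeZero s] {k : Fin s → ℕ} (hk2 : ∀ i, 2 ≤ k i) (hkK : ∀ i, k i ≤ K) (hr : 1 ≤ r) (hD : 0 < D)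
    (hx : J * K ≤ x * D) {F : Finset (Finset V)} {q : ℝ} (hq : 0 < q) (hq1 : q ≤ 1)
    (hF : ∀ S ∈ F, q * Fintype.card V + x + K * ((D * K + 1) ^ r : ℕ) ≤ #S) {j : ℕ} (hj : j ≤ J) :
    ∃ (E : Finset (Finset V)) (lab : Finset V → Fin s), IsSparseLabelled k r D E lab ∧
      #E ≤ j ∧ ((∑ i, #(missedSets F E lab i) : ℕ) : ℝ) ≤
        (1 - q ^ K / (s + 1)) ^ j * (s * 2 ^ Fintype.card V) := by
  induction j with
  | zero =>
    refine ⟨∅, fun _ => 0, ⟨by simp, ?_, by simp⟩, by simp, ?_⟩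
    · rintro t ht - (⟨-, u, v, -, A, hA, -⟩ | ⟨-, f, -, hf⟩)
      · simp at hA
      · obtain ⟨A, hA, -⟩ := hf 0
        simp at hA
    · have : ∑ i : Fin s, #(missedSets F ∅ (fun _ => 0) i) ≤ s * 2 ^ Fintype.card V := by
        refine (sum_le_card_nsmul _ _ (2 ^ Fintype.card V) fun i _ => ?_).trans_eq (by simp)
        exact (card_le_univ _).trans_eq Fintype.card_finset
      rw [pow_zero, one_mul]
      exact_mod_cast this
  | succ j ih =>
    obtain ⟨E, lab, hE, hEj, hm⟩ := ih (by omega)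
    obtain ⟨E', lab', hE', hEj', hm'⟩ := hE.exists_sum_card_missedSets_le hk2 hkK hr hD
      ((Nat.mul_le_mul_right K (hEj.trans (by omega))).trans hx) hq hq1 hF
    refine ⟨E', lab', hE', by omega, hm'.trans ?_⟩
    have hp : q ^ K / (s + 1) ≤ 1 := by
      rw [div_le_one (by positivity)]
      have := pow_le_one₀ hq.le hq1 (n := K)
      have : (0 : ℝ) ≤ s := by positivity
      linarith
    rw [pow_succ', mul_assoc]
    exact mul_le_mul_of_nonneg_left hm (by linarith)

end Greedy

theorem one_sub_pow_mul_two_pow_lt_one {p : ℝ} (hp : 0 < p) (hp1 : p ≤ 1) (s n : ℕ) :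
    (1 - p) ^ ⌈(n + s) / p⌉₊ * (s * 2 ^ n) < 1 := by
  have h1 : (1 - p) ^ ⌈(n + s) / p⌉₊ ≤ Real.exp (-(n + s)) := by
    calc (1 - p) ^ ⌈(n + s) / p⌉₊ ≤ Real.exp (-p) ^ ⌈(n + s) / p⌉₊ :=
          pow_le_pow_left₀ (by linarith) (Real.one_sub_le_exp_neg p) _
      _ = Real.exp (⌈(n + s) / p⌉₊ * (-p)) := (Real.exp_nat_mul _ _).symm
      _ ≤ Real.exp (-(n + s)) := by
          have := Nat.le_ceil ((n + s) / p : ℝ)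
          rw [div_le_iff₀ hp] at this
          exact Real.exp_le_exp.mpr (by linarith)
  have h2 : (s * 2 ^ n : ℝ) < Real.exp (n + s) := by
    have hs : (s : ℝ) < 2 ^ s := by exact_mod_cast Nat.lt_two_pow_self
    have he : (2 : ℝ) ≤ Real.exp 1 := by linarith [Real.add_one_le_exp (1 : ℝ)]
    calc (s * 2 ^ n : ℝ) < 2 ^ s * 2 ^ n := by gcongr
      _ = 2 ^ (n + s) := by ring
      _ ≤ Real.exp 1 ^ (n + s) := by gcongr
      _ = Real.exp (n + s) := by rw [← Real.exp_nat_mul]; simp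
  calc (1 - p) ^ ⌈(n + s) / p⌉₊ * (s * 2 ^ n)
      ≤ Real.exp (-(n + s)) * (s * 2 ^ n) := by gcongr
    _ < Real.exp (-(n + s)) * Real.exp (n + s) := by gcongr
    _ = 1 := by rw [← Real.exp_add]; simp

/-- A choice of degree bound `D` and of the number `x` of saturated vertices for which the greedy
construction can be run long enough. -/
theorem exists_greedy_parameters (s K r : ℕ) (hK : 1 ≤ K) :
    ∃ N : ℕ, ∀ n : ℕ, N ≤ n → 0 < n ∧ ∃ (q : ℝ) (D x : ℕ), 0 < q ∧ q ≤ 1 ∧ 0 < D ∧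
      ⌈(n + s) / (q ^ K / (s + 1))⌉₊ * K ≤ x * D ∧
      q * n + x + K * ((D * K + 1) ^ r : ℕ) ≤ n / Real.log n := by
  have hlog : Filter.Tendsto (fun n : ℕ => Real.log n) Filter.atTop Filter.atTop :=
    Real.tendsto_log_atTop.comp tendsto_natCast_atTop_atTop
  set M := (K + 3) * r + 1 with hM
  set C : ℝ := 4 * K * (3 * K) ^ r with hC
  have hK' : (1 : ℝ) ≤ K := by exact_mod_cast hK
  have hCpos : 0 < C := by positivity
  have hsmall : ∀ᶠ n : ℕ in Filter.atTop, C * Real.log n ^ M ≤ n := by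
    have h1 := (Real.isLittleO_pow_log_id_atTop (n := M)).comp_tendsto
      (tendsto_natCast_atTop_atTop (R := ℝ))
    filter_upwards [h1.bound (inv_pos.mpr hCpos)] with n hn
    simp only [Function.comp, id, Real.norm_eq_abs, Nat.abs_cast] at hn
    rw [← div_eq_inv_mul, le_div_iff₀ hCpos] at hn
    have := le_abs_self (Real.log n ^ M)
    nlinarith
  obtain ⟨N, hN⟩ := Filter.eventually_atTop.mp (hsmall.and ((hlog.eventually_ge_atTop
    (16 * (s + 1) * 4 ^ K * K)).and (Filter.eventually_ge_atTop (s + 2))))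
  refine ⟨N, fun n hn => ?_⟩
  obtain ⟨hCn, hL, hns⟩ := hN n hn
  set L := Real.log n with hLdef
  have hns' : (s + 2 : ℝ) ≤ n := by exact_mod_cast hns
  have hs0 : (0 : ℝ) ≤ s := by positivity
  have h4K : (1 : ℝ) ≤ 4 ^ K := one_le_pow₀ (by norm_num)
  have hL1 : 1 ≤ L := by
    refine le_trans ?_ hL
    have h1 : (1 : ℝ) ≤ 16 * (s + 1) := by linarith
    exact one_le_mul_of_one_le_of_one_le (one_le_mul_of_one_le_of_one_le h1 h4K) hK'
  have hL0 : 0 < L := by linarith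
  have hLp : 1 ≤ L ^ (K + 3) := one_le_pow₀ hL1
  have hn0 : (0 : ℝ) < n := by linarith
  have hx1 : 1 ≤ n / (4 * L) := by
    rw [le_div_iff₀ (by positivity), one_mul]
    refine le_trans ?_ hCn
    have h1 : L ≤ L ^ M := le_self_pow₀ hL1 (by omega)
    have h2 : (1 : ℝ) ≤ (3 * K) ^ r := one_le_pow₀ (by linarith)
    have h3 : 4 ≤ C := by
      rw [hC]
      nlinarith
    gcongr
  refine ⟨by omega, 1 / (4 * L), ⌈L ^ (K + 3)⌉₊, ⌊n / (4 * L)⌋₊, by positivity, ?_,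
    Nat.ceil_pos.mpr (by positivity), ?_, ?_⟩
  · rw [div_le_one (by positivity)]
    linarith
  · have hx : n / (8 * L) ≤ (⌊n / (4 * L)⌋₊ : ℝ) := by
      have h1 : (1 : ℝ) ≤ ⌊n / (4 * L)⌋₊ := by
        exact_mod_cast Nat.le_floor (by exact_mod_cast hx1)
      have h2 := Nat.lt_floor_add_one (n / (4 * L))
      have h3 : n / (8 * L) = n / (4 * L) / 2 := by field_simp; norm_num
      linarith
    have hp : (n + s) / ((1 / (4 * L)) ^ K / (s + 1)) = (n + s) * (s + 1) * (4 ^ K * L ^ K) := by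
      rw [one_div, inv_pow, mul_pow]
      field_simp
    rw [hp]
    have hJ : (⌈(n + s) * (s + 1) * (4 ^ K * L ^ K)⌉₊ : ℝ) ≤
        2 * n * (s + 1) * (4 ^ K * L ^ K) := by
      have h1 := (Nat.ceil_lt_add_one (a := (n + s) * (s + 1) * (4 ^ K * L ^ K))
        (by positivity)).le
      have h2 : 1 ≤ (s + 1) * (4 ^ K * L ^ K) :=
        one_le_mul_of_one_le_of_one_le (by linarith)
          (one_le_mul_of_one_le_of_one_le h4K (one_le_pow₀ hL1))
      nlinarith
    have hreal : (⌈(n + s) * (s + 1) * (4 ^ K * L ^ K)⌉₊ : ℝ) * K ≤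
        ⌊n / (4 * L)⌋₊ * ⌈L ^ (K + 3)⌉₊ := by
      calc (⌈(n + s) * (s + 1) * (4 ^ K * L ^ K)⌉₊ : ℝ) * K
          ≤ 2 * n * (s + 1) * (4 ^ K * L ^ K) * K := by gcongr
        _ = n * L ^ K * (16 * (s + 1) * 4 ^ K * K) / 8 := by ring
        _ ≤ n * L ^ K * L / 8 := by gcongr
        _ ≤ n * L ^ K * (L * L) / 8 := by
            gcongr
            nlinarith
        _ = n / (8 * L) * L ^ (K + 3) := by
            field_simp
            ring
        _ ≤ _ := by
            gcongr
            exact Nat.le_ceil _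
    exact_mod_cast hreal
  · have hx : (⌊n / (4 * L)⌋₊ : ℝ) ≤ n / (4 * L) := Nat.floor_le (by positivity)
    have hDK : (⌈L ^ (K + 3)⌉₊ * K + 1 : ℝ) ≤ 3 * K * L ^ (K + 3) := by
      have h1 := (Nat.ceil_lt_add_one (a := L ^ (K + 3)) (by positivity)).le
      have h2 : (⌈L ^ (K + 3)⌉₊ : ℝ) * K ≤ 2 * L ^ (K + 3) * K := by
        gcongr
        linarith
      nlinarith
    have hball : (K : ℝ) * ((⌈L ^ (K + 3)⌉₊ * K + 1) ^ r : ℕ) ≤ n / (4 * L) := by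
      rw [le_div_iff₀ (by positivity)]
      push_cast
      calc (K : ℝ) * (⌈L ^ (K + 3)⌉₊ * K + 1) ^ r * (4 * L)
          ≤ K * (3 * K * L ^ (K + 3)) ^ r * (4 * L) := by gcongr
        _ = C * L ^ M := by
            rw [hC, hM, mul_pow, ← pow_mul]
            ring
        _ ≤ n := hCn
    have hq : 1 / (4 * L) * n = n / (4 * L) := by ring
    have hsum : n / L = 4 * (n / (4 * L)) := by field_simp
    have : 0 ≤ n / (4 * L) := by positivity
    linarith

/-- Let `k₁,…,k_s ≥ 2` and `r ≥ 2`.  For all sufficiently large `n` there is a hypergraph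
on `n` vertices whose hyperedges are assigned labels in `{1,…,s}`, with every hyperedge of
label `i` having exactly `kᵢ` vertices, such that it has no cycle of length `t` for any
`2 ≤ t ≤ r`, and every vertex subset of size at least `n / log n` contains a hyperedge of
every label. -/
theorem stmt13 (s : ℕ) (k : Fin s → ℕ) (hk : ∀ i, 2 ≤ k i) (r : ℕ) (hr : 2 ≤ r) :
    ∃ N : ℕ, ∀ n : ℕ, N ≤ n →
      ∃ (E : Set (Finset (Fin n))) (lab : (A : Finset (Fin n)) → A ∈ E → Fin s),
        (∀ (A : Finset (Fin n)) (hA : A ∈ E), A.card = k (lab A hA)) ∧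
        (∀ t, 2 ≤ t → t ≤ r → ¬ HypCycle E t) ∧
        (∀ S : Finset (Fin n), (n : ℝ) / Real.log n ≤ (S.card : ℝ) →
          ∀ i : Fin s, ∃ (A : Finset (Fin n)) (hA : A ∈ E), lab A hA = i ∧ A ⊆ S) := by
  obtain rfl | hs := Nat.eq_zero_or_pos s
  · refine ⟨0, fun n _ => ⟨∅, fun A hA => absurd hA (Set.notMem_empty A), ?_, ?_,
      fun S _ i => i.elim0⟩⟩
    · exact fun A hA => absurd hA (Set.notMem_empty A)
    · rintro t ht - (⟨-, u, v, -, A, hA, -⟩ | ⟨-, f, -, hf⟩)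
      · exact hA
      · exact (hf 0).elim fun A hA => hA.1
  have : NeZero s := ⟨hs.ne'⟩
  have hkK : ∀ i, k i ≤ ∑ j, k j := fun i =>
    Finset.single_le_sum (fun j _ => Nat.zero_le (k j)) (Finset.mem_univ i)
  obtain ⟨N, hN⟩ := exists_greedy_parameters s (∑ j, k j) r
    (le_trans (by norm_num) ((hk 0).trans (hkK 0)))
  refine ⟨N, fun n hn => ?_⟩
  obtain ⟨hn0, q, D, x, hq, hq1, hD, hx, hsize⟩ := hN n hn
  have : Nonempty (Fin n) := ⟨⟨0, hn0⟩⟩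
  classical
  obtain ⟨E, lab, hE, -, hm⟩ := exists_isSparseLabelled_sum_card_missedSets_le (V := Fin n)
    (F := Finset.univ.filter fun S => (n : ℝ) / Real.log n ≤ (S.card : ℝ)) hk hkK
    (by omega : 1 ≤ r) hD hx hq hq1
    (fun S hS => by
      rw [Fintype.card_fin]
      exact hsize.trans (Finset.mem_filter.mp hS).2) le_rfl
  have hp1 : q ^ (∑ j, k j) / (s + 1) ≤ 1 := by
    rw [div_le_one (by positivity)]
    have := pow_le_one₀ hq.le hq1 (n := ∑ j, k j)
    have : (0 : ℝ) ≤ s := by positivity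
    linarith
  rw [Fintype.card_fin] at hm
  have hlt := hm.trans_lt (one_sub_pow_mul_two_pow_lt_one (by positivity) hp1 s n)
  have hzero := Nat.lt_one_iff.mp (by exact_mod_cast hlt)
  refine ⟨E, fun A _ => lab A, hE.card_eq, hE.not_cycle, fun S hS i => ?_⟩
  have hi := Finset.card_eq_zero.mp (Finset.sum_eq_zero_iff.mp hzero i (Finset.mem_univ i))
  by_contra hcon
  have hmem : S ∈ missedSets (Finset.univ.filter fun S => (n : ℝ) / Real.log n ≤ (S.card : ℝ))
      E lab i :=
    Finset.mem_filter.mpr ⟨Finset.mem_filter.mpr ⟨Finset.mem_univ S, hS⟩,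
      fun ⟨A, hA, hAi, hAS⟩ => hcon ⟨A, hA, hAi, hAS⟩⟩
  rw [hi] at hmem
  exact Finset.notMem_empty S hmem
end
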